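/- arXiv:2512.24293 — 3 statements merged into one kernel-verified Lean document; each statement's English description precedes it below -/
import Mathlib

section
/- Let G be a finite simple graph admitting a negative quasi neighborhood balanced coloring, and let k denote the number of vertices of G of odd degree. Then 2|E(G)| ≡ k (mod 4). -/
open SimpleGraph

/-- Number of neighbors of `v` in `G` that receive color `col` under the
2-coloring `c` (`true` = red, `false` = blue). -/
noncomputable def nbrCount {V : Type*} (G : SimpleGraph V) (c : V → Bool) (col : Bool) (v : V) : ℕ :=
  {u | G.Adj v u ∧ c u = col}.ncard

/-- A quasi neighborhood balanced coloring: every vertex has red/blue neighbor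
counts differing by at most one, and some vertex has difference exactly one. -/
def IsQNBC {V : Type*} (G : SimpleGraph V) (c : V → Bool) : Prop :=
  (∀ v, |(nbrCount G c true v : ℤ) - (nbrCount G c false v : ℤ)| ≤ 1) ∧
  (∃ v, |(nbrCount G c true v : ℤ) - (nbrCount G c false v : ℤ)| = 1)

/-- A neighborhood balanced coloring: every vertex has equally many red and
blue neighbors. -/
def IsNBC {V : Type*} (G : SimpleGraph V) (c : V → Bool) : Prop :=
  ∀ v, nbrCount G c true v = nbrCount G c false v

/-- A positive QNBC: every imbalanced vertex has one more neighbor of its own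
color than of the opposite color. -/
def IsPosQNBC {V : Type*} (G : SimpleGraph V) (c : V → Bool) : Prop :=
  IsQNBC G c ∧
  ∀ v, |(nbrCount G c true v : ℤ) - (nbrCount G c false v : ℤ)| = 1 →
    nbrCount G c (c v) v = nbrCount G c (!(c v)) v + 1

/-- A negative QNBC: every imbalanced vertex has one more neighbor of the
opposite color than of its own color. -/
def IsNegQNBC {V : Type*} (G : SimpleGraph V) (c : V → Bool) : Prop :=
  IsQNBC G c ∧
  ∀ v, |(nbrCount G c true v : ℤ) - (nbrCount G c false v : ℤ)| = 1 →
    nbrCount G c (!(c v)) v = nbrCount G c (c v) v + 1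

/-- A uniform QNBC: there is a single color `col` such that every imbalanced
vertex has one more neighbor of color `col` than of the other color. -/
def IsUniformQNBC {V : Type*} (G : SimpleGraph V) (c : V → Bool) : Prop :=
  IsQNBC G c ∧
  ∃ col : Bool, ∀ v, |(nbrCount G c true v : ℤ) - (nbrCount G c false v : ℤ)| = 1 →
    nbrCount G c col v = nbrCount G c (!col) v + 1

/-- The spanning subgraph of `G` whose edges join vertices of the same color. -/
def monochromaticSubgraph {V : Type*} (G : SimpleGraph V) (c : V → Bool) : SimpleGraph V where
  Adj u v := G.Adj u v ∧ c u = c v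
  symm := ⟨fun _ _ h => ⟨h.1.symm, h.2.symm⟩⟩
  loopless := ⟨fun _ h => G.loopless.irrefl _ h.1⟩

theorem ncard_neighborSet_monochromaticSubgraph {V : Type*} (G : SimpleGraph V) (c : V → Bool)
    (v : V) : ((monochromaticSubgraph G c).neighborSet v).ncard = nbrCount G c (c v) v := by
  unfold nbrCount
  congr 1
  ext u
  simp [monochromaticSubgraph, eq_comm]

theorem ncard_neighborSet_eq_nbrCount_add {V : Type*} [Finite V] (G : SimpleGraph V)
    (c : V → Bool) (col : Bool) (v : V) :
    (G.neighborSet v).ncard = nbrCount G c col v + nbrCount G c (!col) v := by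
  unfold nbrCount
  rw [← Set.ncard_union_eq _ (Set.toFinite _) (Set.toFinite _)]
  · congr 1
    ext u
    cases col <;> cases h : c u <;> simp [h]
  · rw [Set.disjoint_left]
    rintro u ⟨_, h⟩ ⟨_, h'⟩
    cases col <;> simp_all

theorem sum_ncard_neighborSet {V : Type*} [Fintype V] (G : SimpleGraph V) :
    ∑ v, (G.neighborSet v).ncard = 2 * G.edgeSet.ncard := by
  classical
  rw [← SimpleGraph.coe_edgeFinset, Set.ncard_coe_finset, ← G.sum_degrees_eq_twice_card_edges]
  refine Finset.sum_congr rfl fun v _ => ?_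
  rw [Set.ncard_eq_toFinset_card', ← SimpleGraph.neighborFinset_def,
    SimpleGraph.card_neighborFinset_eq_degree]

open Classical in
theorem IsNegQNBC.ncard_neighborSet_eq {V : Type*} [Finite V] {G : SimpleGraph V} {c : V → Bool}
    (h : IsNegQNBC G c) (v : V) :
    (G.neighborSet v).ncard = 2 * ((monochromaticSubgraph G c).neighborSet v).ncard +
      if Odd (G.neighborSet v).ncard then 1 else 0 := by
  have hdeg := ncard_neighborSet_eq_nbrCount_add G c (c v) v
  have hle := h.1.1 v
  have hneg := h.2 v
  rw [ncard_neighborSet_monochromaticSubgraph, hdeg]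
  rcases eq_or_ne (nbrCount G c true v) (nbrCount G c false v) with heq | hne
  · have : nbrCount G c (!(c v)) v = nbrCount G c (c v) v := by
      cases c v <;> simp [heq]
    rw [this, if_neg (by grind)]
    ring
  · have habs := hneg (by rw [abs_le] at hle; rw [abs_eq (by norm_num)]; omega)
    rw [habs, if_pos (by grind)]
    ring

theorem stmt_2 {V : Type*} [Fintype V] (G : SimpleGraph V) (c : V → Bool)
    (h : IsNegQNBC G c) :
    (2 * (G.edgeSet.ncard : ℤ)) ≡
      (({v : V | Odd (G.neighborSet v).ncard}.ncard : ℤ)) [ZMOD 4] := by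
  classical
  have hcard : {v : V | Odd (G.neighborSet v).ncard}.ncard =
      ∑ v, if Odd (G.neighborSet v).ncard then 1 else 0 := by
    rw [Finset.sum_boole, Nat.cast_id, ← Set.ncard_coe_finset]
    simp
  have hsum := Finset.sum_congr rfl fun v (_ : v ∈ Finset.univ) => h.ncard_neighborSet_eq v
  rw [Finset.sum_add_distrib, ← Finset.mul_sum, sum_ncard_neighborSet, sum_ncard_neighborSet,
    ← hcard] at hsum
  rw [Int.ModEq]
  omega
end

section
/- Let G and H be finite simple graphs with G nonempty (having at least one vertex). If G admits a neighborhood balanced coloring and H admits a quasi neighborhood balanced coloring, then the lexicographic product G[H] admits a quasi neighborhood balanced coloring. -/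
open SimpleGraph

/-- The lexicographic product `G[H]`. -/
def lexProd {V W : Type*} (G : SimpleGraph V) (H : SimpleGraph W) :
    SimpleGraph (V × W) :=
  SimpleGraph.fromRel (fun x y =>
    G.Adj x.1 y.1 ∨ (x.1 = y.1 ∧ H.Adj x.2 y.2))

/-- The value `1` for red and `-1` for blue. -/
def colorSign (b : Bool) : ℤ := if b then 1 else -1

lemma colorSign_beq (a b : Bool) : colorSign (a == b) = colorSign a * colorSign b := by
  cases a <;> cases b <;> rfl

lemma abs_colorSign (b : Bool) : |colorSign b| = 1 := by
  cases b <;> rfl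

open Classical in
lemma nbrCount_sub_eq_sum {V : Type*} [Fintype V] (G : SimpleGraph V) (c : V → Bool) (v : V) :
    (nbrCount G c true v : ℤ) - (nbrCount G c false v : ℤ) =
      ∑ u, if G.Adj v u then colorSign (c u) else 0 := by
  have key (col : Bool) :
      (nbrCount G c col v : ℤ) = ∑ u, if G.Adj v u ∧ c u = col then 1 else 0 := by
    rw [nbrCount, Set.ncard_eq_toFinset_card']
    simp [Finset.sum_boole]
  rw [key, key, ← Finset.sum_sub_distrib]
  refine Finset.sum_congr rfl fun u _ => ?_
  by_cases h : G.Adj v u <;> cases hc : c u <;> simp [h, colorSign]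

lemma lexProd_adj {V W : Type*} (G : SimpleGraph V) (H : SimpleGraph W) (x y : V × W) :
    (lexProd G H).Adj x y ↔ G.Adj x.1 y.1 ∨ (x.1 = y.1 ∧ H.Adj x.2 y.2) := by
  rw [lexProd, SimpleGraph.fromRel_adj]
  constructor
  · rintro ⟨-, h | h | ⟨h, h'⟩⟩
    · exact h
    · exact .inl h.symm
    · exact .inr ⟨h.symm, h'.symm⟩
  · intro h
    refine ⟨?_, .inl h⟩
    rintro rfl
    simp at h

/-- If `g` is neighborhood balanced, then the imbalance of the coloring `(u, w) ↦ (g u == h w)` of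
`G[H]` at a vertex is, up to sign, the imbalance of `h` at its second coordinate. -/
lemma lexProd_nbrCount_sub {V W : Type*} [Fintype V] [Fintype W]
    (G : SimpleGraph V) (H : SimpleGraph W) {g : V → Bool} (hg : IsNBC G g) (h : W → Bool)
    (x : V × W) :
    (nbrCount (lexProd G H) (fun y => g y.1 == h y.2) true x : ℤ) -
        (nbrCount (lexProd G H) (fun y => g y.1 == h y.2) false x : ℤ) =
      colorSign (g x.1) * ((nbrCount H h true x.2 : ℤ) - (nbrCount H h false x.2 : ℤ)) := by
  classical
  have hg0 : (∑ u, if G.Adj x.1 u then colorSign (g u) else 0) = 0 := by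
    have := nbrCount_sub_eq_sum G g x.1
    rw [hg x.1, sub_self] at this
    convert this.symm
  have split (u : V) (w : W) :
      (if (lexProd G H).Adj x (u, w) then colorSign (g u == h w) else 0) =
        (if G.Adj x.1 u then colorSign (g u) else 0) * colorSign (h w) +
        (if x.1 = u then
          colorSign (g u) * (if H.Adj x.2 w then colorSign (h w) else 0) else 0) := by
    simp only [lexProd_adj, colorSign_beq]
    by_cases hu : x.1 = u
    · subst hu
      simp
    · simp [hu]
  rw [nbrCount_sub_eq_sum, nbrCount_sub_eq_sum, Fintype.sum_prod_type]
  simp only [split, Finset.sum_add_distrib]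
  rw [← Finset.sum_mul_sum, hg0, zero_mul, zero_add, Finset.sum_comm, Finset.mul_sum]
  simp

theorem stmt_10 {V W : Type*} [Fintype V] [Fintype W] [Nonempty V]
    (G : SimpleGraph V) (H : SimpleGraph W)
    (hG : ∃ g : V → Bool, IsNBC G g)
    (hH : ∃ h : W → Bool, IsQNBC H h) :
    ∃ c : V × W → Bool, IsQNBC (lexProd G H) c := by
  obtain ⟨g, hg⟩ := hG
  obtain ⟨h, hle, w, hw⟩ := hH
  obtain ⟨v⟩ := ‹Nonempty V›
  refine ⟨fun y => g y.1 == h y.2, fun x => ?_, (v, w), ?_⟩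
  · rw [lexProd_nbrCount_sub G H hg, abs_mul, abs_colorSign, one_mul]
    exact hle x.2
  · rw [lexProd_nbrCount_sub G H hg, abs_mul, abs_colorSign, one_mul]
    exact hw
end

section
/- Let G and H be finite simple graphs. If G admits a quasi neighborhood balanced coloring g in which the number of red vertices exceeds the number of blue vertices by exactly one, and H admits a neighborhood balanced coloring h in which the number of red vertices equals the number of blue vertices, then the join G ∨ H admits a quasi neighborhood balanced coloring. -/
open SimpleGraph

/-- The join `G ∨ H`: disjoint union of `G` and `H` together with all edges
between them. -/
def joinGraph {V W : Type*} (G : SimpleGraph V) (H : SimpleGraph W) :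
    SimpleGraph (V ⊕ W) :=
  SimpleGraph.fromRel (fun x y =>
    match x, y with
    | Sum.inl a, Sum.inl b => G.Adj a b
    | Sum.inr a, Sum.inr b => H.Adj a b
    | _, _ => True)

/-- The disjoint union of the images of two finite sets under the two injections of a sum type
has the sum of their cardinalities. -/
theorem ncard_inl_union_inr {V W : Type*} [Finite V] [Finite W] (s : Set V) (t : Set W) :
    (Sum.inl '' s ∪ Sum.inr '' t).ncard = s.ncard + t.ncard := by
  rw [Set.ncard_union_eq (by
      rw [Set.disjoint_left]
      rintro _ ⟨a, _, rfl⟩ ⟨b, _, hb⟩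
      cases hb) (Set.toFinite _) (Set.toFinite _),
    Set.ncard_image_of_injective _ Sum.inl_injective,
    Set.ncard_image_of_injective _ Sum.inr_injective]

theorem nbrCount_joinGraph_inl {V W : Type*} [Finite V] [Finite W]
    (G : SimpleGraph V) (H : SimpleGraph W) (c : V ⊕ W → Bool) (col : Bool) (v : V) :
    nbrCount (joinGraph G H) c col (Sum.inl v) =
      nbrCount G (c ∘ Sum.inl) col v + {w : W | c (Sum.inr w) = col}.ncard := by
  unfold nbrCount
  rw [← ncard_inl_union_inr]
  congr 1
  ext (a | b)
  · simpa [joinGraph, G.adj_comm a v] using fun _ hva => hva.ne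
  · simp [joinGraph]

theorem nbrCount_joinGraph_inr {V W : Type*} [Finite V] [Finite W]
    (G : SimpleGraph V) (H : SimpleGraph W) (c : V ⊕ W → Bool) (col : Bool) (w : W) :
    nbrCount (joinGraph G H) c col (Sum.inr w) =
      {v : V | c (Sum.inl v) = col}.ncard + nbrCount H (c ∘ Sum.inr) col w := by
  unfold nbrCount
  rw [← ncard_inl_union_inr]
  congr 1
  ext (a | b)
  · simp [joinGraph]
  · simpa [joinGraph, H.adj_comm b w] using fun _ hwb => hwb.ne

theorem stmt_18 {V W : Type*} [Fintype V] [Fintype W]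
    (G : SimpleGraph V) (H : SimpleGraph W)
    (g : V → Bool) (hg : IsQNBC G g)
    (hgbal : {v : V | g v = true}.ncard = {v : V | g v = false}.ncard + 1)
    (h : W → Bool) (hh : IsNBC H h)
    (hhbal : {w : W | h w = true}.ncard = {w : W | h w = false}.ncard) :
    ∃ c : V ⊕ W → Bool, IsQNBC (joinGraph G H) c := by
  have hinl : ∀ v, (nbrCount (joinGraph G H) (Sum.elim g h) true (Sum.inl v) : ℤ) -
      nbrCount (joinGraph G H) (Sum.elim g h) false (Sum.inl v) =
      nbrCount G g true v - nbrCount G g false v := by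
    intro v
    simp only [nbrCount_joinGraph_inl, Sum.elim_comp_inl, Sum.elim_inr]
    lia
  have hinr : ∀ w, (nbrCount (joinGraph G H) (Sum.elim g h) true (Sum.inr w) : ℤ) -
      nbrCount (joinGraph G H) (Sum.elim g h) false (Sum.inr w) = 1 := by
    intro w
    have := hh w
    simp only [nbrCount_joinGraph_inr, Sum.elim_comp_inr, Sum.elim_inl]
    lia
  obtain ⟨hle, v, hv⟩ := hg
  refine ⟨Sum.elim g h, ?_, Sum.inl v, by rw [hinl, hv]⟩
  rintro (a | b)
  · rw [hinl]
    exact hle a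
  · simp [hinr]
end
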